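/- arXiv:1701.06383 — 2 statements merged into one kernel-verified Lean document; each statement's English description precedes it below -/
import Mathlib

section
/- Let A and B be unital C*-algebras and φ : A → B an arbitrary function. Then φ is a unital *-homomorphism if and only if φ is ℂ-homogeneous (φ(λx) = λφ(x) for all x ∈ A and λ ∈ ℂ) and the entrywise map φ ⊗ id_{M₁₆} : M₁₆(A) → M₁₆(B) restricts to a group homomorphism from the unitary group U(M₁₆(A)) to the unitary group U(M₁₆(B)) (i.e. it maps unitaries to unitaries and (φ ⊗ id_{M₁₆})(uv) = (φ ⊗ id_{M₁₆})(u) · (φ ⊗ id_{M₁₆})(v) for all unitaries u, v ∈ M₁₆(A)). -/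
open Matrix in
/-- A column isometry can be completed to a unitary. -/
theorem col_unitary {A : Type*} [CStarAlgebra A] (V : Fin 15 → A)
    (hV : ∑ i, star (V i) * V i = 1) :
    ∃ u ∈ unitary (Matrix (Fin 16) (Fin 16) A),
      (∀ i : Fin 15, u i.castSucc 0 = V i) ∧ u (Fin.last 15) 0 = 0 := by
  let W : Matrix (Fin 15) (Fin 1) A := Matrix.of fun i _ => V i
  have hW : Wᴴ * W = 1 := by
    ext i j
    have hij : i = j := Subsingleton.elim _ _
    subst hij
    simpa [W, Matrix.mul_apply] using hV
  have hW2 : W * Wᴴ * W = W := by rw [Matrix.mul_assoc, hW, Matrix.mul_one]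
  have hW3 : Wᴴ * (W * Wᴴ) = Wᴴ := by rw [← Matrix.mul_assoc, hW, Matrix.one_mul]
  have hW4 : W * Wᴴ * (W * Wᴴ) = W * Wᴴ := by rw [← Matrix.mul_assoc, hW2]
  let M : Matrix (Fin 15 ⊕ Fin 1) (Fin 1 ⊕ Fin 15) A := fromBlocks W (1 - W * Wᴴ) 0 Wᴴ
  have hM1 : Mᴴ * M = 1 := by
    simp only [M, fromBlocks_conjTranspose, fromBlocks_multiply, conjTranspose_sub,
      conjTranspose_one, conjTranspose_mul, conjTranspose_conjTranspose, conjTranspose_zero,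
      Matrix.mul_sub, Matrix.sub_mul, Matrix.mul_one, Matrix.one_mul, hW, hW2, hW3, hW4]
    rw [← fromBlocks_one]
    congr 1 <;> simp
  have hM2 : M * Mᴴ = 1 := by
    simp only [M, fromBlocks_conjTranspose, fromBlocks_multiply, conjTranspose_sub,
      conjTranspose_one, conjTranspose_mul, conjTranspose_conjTranspose, conjTranspose_zero,
      Matrix.mul_sub, Matrix.sub_mul, Matrix.mul_one, Matrix.one_mul, hW, hW2, hW3, hW4]
    rw [← fromBlocks_one]
    congr 1 <;> simp
  let e1 : Fin 16 ≃ Fin 15 ⊕ Fin 1 := (finSumFinEquiv (m := 15) (n := 1)).symm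
  let e2 : Fin 16 ≃ Fin 1 ⊕ Fin 15 := (finSumFinEquiv (m := 1) (n := 15)).symm
  have h0 : e2 0 = Sum.inl 0 := by
    rw [Equiv.symm_apply_eq]; rfl
  refine ⟨M.submatrix e1 e2, ?_, ?_, ?_⟩
  · rw [Unitary.mem_iff, star_eq_conjTranspose, conjTranspose_submatrix,
      submatrix_mul_equiv, submatrix_mul_equiv, hM1, hM2]
    simp
  · intro i
    have h1 : e1 i.castSucc = Sum.inl i := by
      rw [Equiv.symm_apply_eq]; rfl
    simp [h0, h1, M, W]
  · have h1 : e1 (Fin.last 15) = Sum.inr 0 := by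
      rw [Equiv.symm_apply_eq]; rfl
    rw [Matrix.submatrix_apply, h0, h1]; rfl

theorem exists_compl {A : Type*} [CStarAlgebra A] (b : A) (hb : ∃ x y : A, b = star x * x + star y * y)
    (h : ‖b‖ ≤ 1) : ∃ s : A, b + star s * s = 1 := by
  letI := CStarAlgebra.spectralOrder A
  haveI := CStarAlgebra.spectralOrderedRing A
  obtain ⟨x, y, rfl⟩ := hb
  have hsa : IsSelfAdjoint (star x * x + star y * y) :=
    (IsSelfAdjoint.star_mul_self x).add (IsSelfAdjoint.star_mul_self y)
  have h1 : star x * x + star y * y ≤ 1 := by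
    refine hsa.le_algebraMap_norm_self.trans ?_
    simpa using algebraMap_mono A h
  obtain ⟨s, hs⟩ := CStarAlgebra.nonneg_iff_eq_star_mul_self.mp (sub_nonneg.mpr h1)
  exact ⟨s, by rw [← hs]; abel⟩

theorem exists_scale {A : Type*} [CStarAlgebra A] (x y : A) :
    ∃ t : ℂ, t ≠ 0 ∧ ∃ s : A,
      star (t • x) * (t • x) + star (t • y) * (t • y) + star s * s = 1 := by
  set b := star x * x + star y * y with hb
  have hpos : 0 < 1 + ‖b‖ := by positivity
  refine ⟨((1 + ‖b‖ : ℝ) : ℂ)⁻¹, by simpa using (by exact_mod_cast hpos.ne'), ?_⟩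
  refine exists_compl _ ⟨_, _, rfl⟩ ?_
  have : ∀ t : ℂ, star (t • x) * (t • x) + star (t • y) * (t • y) = (star t * t) • b := by
    intro t
    simp only [hb, smul_add, star_smul, smul_mul_smul_comm]
  rw [this, norm_smul, norm_mul, norm_star, norm_inv, Complex.norm_real, Real.norm_of_nonneg hpos.le]
  have h1 : (1 + ‖b‖)⁻¹ ≤ 1 := inv_le_one_of_one_le₀ (by linarith [norm_nonneg b])
  have h2 : (1 + ‖b‖)⁻¹ * ‖b‖ ≤ 1 := by
    rw [inv_mul_le_iff₀ hpos]; linarith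
  have h3 : 0 ≤ (1 + ‖b‖)⁻¹ * ‖b‖ := by positivity
  have h4 : 0 ≤ (1 + ‖b‖)⁻¹ := by positivity
  nlinarith

theorem col3 {A : Type*} [CStarAlgebra A] (x y z : A)
    (h : star x * x + star y * y + star z * z = 1) :
    ∃ u ∈ unitary (Matrix (Fin 16) (Fin 16) A),
      u 0 0 = x ∧ u 1 0 = y ∧ u 2 0 = z ∧ ∀ i : Fin 13, u (i.natAdd 3) 0 = 0 := by
  obtain ⟨u, hu, h1, h2⟩ := col_unitary (A := A)
    (Fin.append (m := 3) (n := 12) ![x, y, z] 0) (by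
      have := Fin.sum_univ_add (a := 3) (b := 12) (fun i =>
        star (Fin.append (m := 3) (n := 12) ![x, y, z] 0 i) *
          Fin.append (m := 3) (n := 12) ![x, y, z] 0 i)
      refine this.trans ?_
      simp only [Fin.append_left, Fin.append_right]
      simpa [Fin.sum_univ_three] using h)
  refine ⟨u, hu, h1 0, h1 1, h1 2, ?_⟩
  intro i
  induction i using Fin.lastCases with
  | last => exact h2
  | cast i =>
    have := h1 (i.natAdd 3)
    rw [Fin.append_right] at this
    exact this

theorem key {A B : Type*} [CStarAlgebra A] [CStarAlgebra B] (φ : A → B) (h0 : φ 0 = 0)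
    (hm : ∀ u v : Matrix (Fin 16) (Fin 16) A,
          u ∈ unitary (Matrix (Fin 16) (Fin 16) A) →
          v ∈ unitary (Matrix (Fin 16) (Fin 16) A) →
          (u * v).map φ = u.map φ * v.map φ) (a b c x y z : A)
    (h : star a * a + star b * b + star c * c = 1)
    (h' : star x * x + star y * y + star z * z = 1) :
    φ (star a * x + star b * y + star c * z)
      = φ (star a) * φ x + φ (star b) * φ y + φ (star c) * φ z := by
  obtain ⟨u, hu, u0, u1, u2, u3⟩ := col3 a b c h
  obtain ⟨v, hv, v0, v1, v2, v3⟩ := col3 x y z h'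
  have := congrFun (congrFun (hm (star u) v (Unitary.star_mem hu) hv) 0) 0
  rw [Matrix.map_apply, Matrix.mul_apply, Matrix.mul_apply] at this
  have e1 := Fin.sum_univ_add (a := 3) (b := 13) (fun j => (star u) 0 j * v j 0)
  have e2 := Fin.sum_univ_add (a := 3) (b := 13)
    (fun j => (star u).map φ 0 j * v.map φ j 0)
  rw [show (∑ j : Fin 16, (star u) 0 j * v j 0) = _ from e1,
    show (∑ j : Fin 16, (star u).map φ 0 j * v.map φ j 0) = _ from e2] at this
  simp only [Matrix.map_apply, Matrix.star_apply, u3, v3, h0, mul_zero, Finset.sum_const_zero,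
    add_zero, Fin.sum_univ_three] at this
  rw [← u0, ← u1, ← u2, ← v0, ← v1, ← v2]
  exact this

/-- Let `A` and `B` be unital C*-algebras and `φ : A → B` an
arbitrary function.  Then `φ` is a unital `*`-homomorphism if and only if
`φ` is `ℂ`-homogeneous and the entrywise map `φ ⊗ id_{M₁₆}` restricts to a
group homomorphism `U(M₁₆(A)) → U(M₁₆(B))`. -/
theorem stmt_8 {A B : Type*} [CStarAlgebra A] [CStarAlgebra B] (φ : A → B) :
    (φ 1 = 1 ∧ (∀ x y, φ (x + y) = φ x + φ y) ∧
        (∀ (c : ℂ) (x), φ (c • x) = c • φ x) ∧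
        (∀ x y, φ (x * y) = φ x * φ y) ∧ (∀ x, φ (star x) = star (φ x))) ↔
      ((∀ (c : ℂ) (x), φ (c • x) = c • φ x) ∧
        (∀ u : Matrix (Fin 16) (Fin 16) A,
          u ∈ unitary (Matrix (Fin 16) (Fin 16) A) →
          u.map φ ∈ unitary (Matrix (Fin 16) (Fin 16) B)) ∧
        (∀ u v : Matrix (Fin 16) (Fin 16) A,
          u ∈ unitary (Matrix (Fin 16) (Fin 16) A) →
          v ∈ unitary (Matrix (Fin 16) (Fin 16) A) →
          (u * v).map φ = u.map φ * v.map φ)) := by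
  constructor
  · rintro ⟨h1, ha, hs, hm, hst⟩
    let f : A →ₐ[ℂ] B := AlgHom.ofLinearMap ⟨⟨φ, ha⟩, hs⟩ h1 hm
    have hmul : ∀ u v : Matrix (Fin 16) (Fin 16) A, (u * v).map φ = u.map φ * v.map φ :=
      fun u v => Matrix.map_mul (f := f.toRingHom)
    have h0 : φ 0 = 0 := map_zero f
    have hone : (1 : Matrix (Fin 16) (Fin 16) A).map φ = 1 := Matrix.map_one φ h0 h1
    have hstar : ∀ u : Matrix (Fin 16) (Fin 16) A, (star u).map φ = star (u.map φ) := by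
      intro u
      ext i j
      simp [Matrix.star_apply, hst]
    refine ⟨hs, ?_, fun u v _ _ => hmul u v⟩
    intro u hu
    rw [Unitary.mem_iff] at hu ⊢
    rw [← hstar, ← hmul, ← hmul, hu.1, hu.2]
    exact ⟨hone, hone⟩
  · rintro ⟨hs, hu, hm⟩
    have h0 : φ 0 = 0 := by simpa using hs 0 0
    have hone : (1 : Matrix (Fin 16) (Fin 16) A).map φ = 1 := by
      have h1 := hm 1 1 (one_mem _) (one_mem _)
      have h2 := (Unitary.mem_iff.mp (hu 1 (one_mem _))).1
      rw [mul_one] at h1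
      calc _ = (star ((1 : Matrix (Fin 16) (Fin 16) A).map φ) * (1 : Matrix (Fin 16) (Fin 16) A).map φ)
              * (1 : Matrix (Fin 16) (Fin 16) A).map φ := by rw [h2, one_mul]
        _ = _ := by rw [mul_assoc, ← h1, h2]
    have h1 : φ 1 = 1 := by simpa using congrFun (congrFun hone 0) 0
    have hk := key φ h0 hm
    have hadd' : ∀ x y, φ ((3/5 : ℂ) • x + (4/5 : ℂ) • y) = (3/5 : ℂ) • φ x + (4/5 : ℂ) • φ y := by
      intro x y
      obtain ⟨t, ht, s, hts⟩ := exists_scale x y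
      have := hk ((3/5 : ℂ) • 1) ((4/5 : ℂ) • 1) 0 (t • x) (t • y) s (by
        simp [smul_smul, ← add_smul]; norm_num) hts
      have e3 : star (3/5 : ℂ) = 3/5 := by simp
      have e4 : star (4/5 : ℂ) = 4/5 := by simp
      simp only [star_smul, star_one, e3, e4, star_zero, zero_mul, add_zero, h0, hs, h1,
        smul_mul_assoc, one_mul] at this
      rw [smul_comm _ t x, smul_comm _ t y, ← smul_add, hs, smul_comm _ t (φ x),
        smul_comm _ t (φ y), ← smul_add] at this
      exact smul_right_injective _ ht this
    have hadd : ∀ x y, φ (x + y) = φ x + φ y := by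
      intro x y
      have := hadd' ((5/3 : ℂ) • x) ((5/4 : ℂ) • y)
      simp only [hs, smul_smul] at this
      norm_num at this
      exact this
    refine ⟨h1, hadd, hs, ?_, ?_⟩
    · intro x y
      obtain ⟨t, ht, s, hts⟩ := exists_scale (star x) 0
      obtain ⟨r, hr, q, hrq⟩ := exists_scale y 0
      have := hk (t • star x) s 0 (r • y) 0 q (by simpa using hts) (by simpa using hrq)
      simp only [star_smul, star_star, star_zero, zero_mul, mul_zero, add_zero, h0, hs,
        smul_mul_smul_comm] at this
      exact smul_right_injective _ (mul_ne_zero (star_ne_zero.mpr ht) hr) this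
    · intro x
      obtain ⟨t, ht, s, hts⟩ := exists_scale x 0
      obtain ⟨u, huu, u0, -⟩ := col3 (t • x) (t • 0) s hts
      have h2 := hm (star u) u (Unitary.star_mem huu) huu
      rw [(Unitary.mem_iff.mp huu).1, hone] at h2
      have h3 : (star u).map φ = star (u.map φ) := by
        calc _ = (star u).map φ * (u.map φ * star (u.map φ)) := by
              rw [(Unitary.mem_iff.mp (hu u huu)).2, mul_one]
          _ = _ := by rw [← mul_assoc, ← h2, one_mul]
      have h4 := congrFun (congrFun h3 0) 0
      simp only [Matrix.map_apply, Matrix.star_apply, u0, star_smul, hs] at h4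
      exact smul_right_injective _ (star_ne_zero.mpr ht) h4
end

section
/- Let A and B be C*-algebras with A unital, and let φ : GL(M₂(A)) → B be an arbitrary function on the group of invertible elements of M₂(A). Then φ extends to a *-homomorphism M₂(A) → B if and only if φ is a *-semigroup homomorphism (φ(xy) = φ(x)φ(y) and φ(x*) = φ(x)* for all invertible x, y) which is uniformly continuous and satisfies: φ of the matrix [[i,0],[0,i]] equals the limit, as λ → 0 with λ > 0 real, of i·φ([[1,λ],[λ,0]]) + i·φ([[0,λ],[λ,1]]). -/
attribute [local instance] Matrix.linftyOpNormedRing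

/-- Extension of a uniformly continuous *-semigroup homomorphism to the closure. -/
theorem ext_closure {M B : Type*} [Monoid M] [StarMul M] [UniformSpace M] [ContinuousMul M]
    [ContinuousStar M] [NonUnitalCStarAlgebra B] (φ : M → B) 
    (hm : ∀ x y : M, IsUnit x → IsUnit y → φ (x * y) = φ x * φ y)
    (hs : ∀ x : M, IsUnit x → φ (star x) = star (φ x))
    (hu : UniformContinuousOn φ {z : M | IsUnit z}) :
    ∃ F : M → B, (∀ x, IsUnit x → F x = φ x) ∧ 
      ContinuousOn F (closure {z : M | IsUnit z}) ∧
      (∀ x ∈ closure {z : M | IsUnit z}, ∀ y ∈ closure {z : M | IsUnit z}, 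
        x * y ∈ closure {z : M | IsUnit z} ∧ F (x * y) = F x * F y) ∧
      (∀ x ∈ closure {z : M | IsUnit z}, F (star x) = star (F x)) := by
  set G : Set M := {z : M | IsUnit z} with hG
  have hlim : ∀ x ∈ closure G, ∃ y, Filter.Tendsto φ (nhdsWithin x G) (nhds y) := by
    intro x hx
    have : (nhdsWithin x G).NeBot := mem_closure_iff_nhdsWithin_neBot.1 hx
    have hc : Cauchy (nhdsWithin x G) := cauchy_nhds.mono nhdsWithin_le_nhds
    exact CompleteSpace.complete (hc.map_of_le hu inf_le_right)
  have hF : ∀ x ∈ closure G, Filter.Tendsto φ (nhdsWithin x G) (nhds (extendFrom G φ x)) :=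
    fun x hx => tendsto_extendFrom (hlim x hx)
  have hmulc : ∀ x y, Filter.Tendsto (fun p : M × M => p.1 * p.2)
      (nhdsWithin x G ×ˢ nhdsWithin y G) (nhdsWithin (x * y) G) := by
    intro x y
    refine tendsto_nhdsWithin_iff.2 ⟨?_, ?_⟩
    · have : Filter.Tendsto (fun p : M × M => p.1 * p.2) (nhds x ×ˢ nhds y) (nhds (x * y)) :=
        nhds_prod_eq (x := x) (y := y) ▸ tendsto_mul
      exact this.mono_left (Filter.prod_mono nhdsWithin_le_nhds nhdsWithin_le_nhds)
    · have := Filter.prod_mem_prod (self_mem_nhdsWithin (a := x) (s := G))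
        (self_mem_nhdsWithin (a := y) (s := G))
      filter_upwards [this] with p hp
      exact IsUnit.mul hp.1 hp.2
  refine ⟨extendFrom G φ, ?_, continuousOn_extendFrom le_rfl hlim, ?_, ?_⟩
  · intro x hx
    exact extendFrom_eq (subset_closure hx) (hu.continuousOn x hx)
  · intro x hx y hy
    have n1 : (nhdsWithin x G).NeBot := mem_closure_iff_nhdsWithin_neBot.1 hx
    have n2 : (nhdsWithin y G).NeBot := mem_closure_iff_nhdsWithin_neBot.1 hy
    have hxy : x * y ∈ closure G := 
      mem_closure_iff_nhdsWithin_neBot.2 ((Filter.NeBot.map inferInstance _).mono (hmulc x y))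
    refine ⟨hxy, ?_⟩
    have t1 := (hF _ hxy).comp (hmulc x y)
    have t2 := ((hF x hx).comp Filter.tendsto_fst).mul 
      ((hF y hy).comp (Filter.tendsto_snd (f := nhdsWithin x G)))
    refine tendsto_nhds_unique (t1.congr' ?_) t2
    have := Filter.prod_mem_prod (self_mem_nhdsWithin (a := x) (s := G))
        (self_mem_nhdsWithin (a := y) (s := G))
    filter_upwards [this] with p hp
    exact hm _ _ hp.1 hp.2
  · intro x hx
    have n1 : (nhdsWithin x G).NeBot := mem_closure_iff_nhdsWithin_neBot.1 hx
    have hc : Filter.Tendsto (star : M → M) (nhdsWithin x G) (nhdsWithin (star x) G) := by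
      refine tendsto_nhdsWithin_iff.2 ⟨continuous_star.continuousAt.mono_left nhdsWithin_le_nhds, ?_⟩
      filter_upwards [self_mem_nhdsWithin] with p hp
      exact IsUnit.star hp
    have hxy : star x ∈ closure G := 
      mem_closure_iff_nhdsWithin_neBot.2 ((Filter.NeBot.map inferInstance _).mono hc)
    refine tendsto_nhds_unique (((hF _ hxy).comp hc).congr' ?_) (hF x hx).star
    filter_upwards [self_mem_nhdsWithin] with p hp
    exact hs _ hp

section
variable {A B : Type*} [CStarAlgebra A] [NonUnitalCStarAlgebra B]

theorem unit_swap (a b : A) (l : ℂ) (hl : l ≠ 0) (h : a = 0 ∨ b = 0) :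
    IsUnit !![a, l • 1; l • 1, b] := by
  refine ⟨⟨!![a, l • 1; l • 1, b], !![-((l⁻¹ * l⁻¹) • b), l⁻¹ • 1; l⁻¹ • 1, -((l⁻¹ * l⁻¹) • a)], ?_, ?_⟩, rfl⟩ <;>
  · rw [Matrix.mul_fin_two, Matrix.one_fin_two]
    rcases h with rfl | rfl <;> simp [smul_smul, hl]

theorem diag_mem (a : A) : !![a, 0; 0, 0] ∈ 
    closure {z : Matrix (Fin 2) (Fin 2) A | IsUnit z} := by
  have : Filter.Tendsto (fun l : ℂ => !![a, l • 1; l • 1, 0]) (nhdsWithin 0 {0}ᶜ)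
      (nhds !![a, 0; 0, 0]) := by
    have hc : Continuous (fun l : ℂ => !![a, l • 1; l • 1, 0]) := by
      refine continuous_matrix fun i j => ?_
      fin_cases i <;> fin_cases j <;> simp <;> fun_prop
    have := hc.tendsto 0
    simp only [zero_smul] at this
    exact this.mono_left nhdsWithin_le_nhds
  refine mem_closure_of_tendsto this ?_
  filter_upwards [self_mem_nhdsWithin] with l hl
  exact unit_swap a 0 l hl (Or.inr rfl)


theorem backward (φ : Matrix (Fin 2) (Fin 2) A → B)
    (hm : ∀ x y : Matrix (Fin 2) (Fin 2) A, IsUnit x → IsUnit y → φ (x * y) = φ x * φ y)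
    (hs : ∀ x : Matrix (Fin 2) (Fin 2) A, IsUnit x → φ (star x) = star (φ x))
    (hu : UniformContinuousOn φ {z : Matrix (Fin 2) (Fin 2) A | IsUnit z})
    (hl : Filter.Tendsto
          (fun lam : ℝ =>
            Complex.I • φ !![(1 : A), (lam : ℂ) • 1; (lam : ℂ) • 1, 0] +
            Complex.I • φ !![(0 : A), (lam : ℂ) • 1; (lam : ℂ) • 1, 1])
          (nhdsWithin 0 (Set.Ioi 0))
          (nhds (φ (Complex.I • (1 : Matrix (Fin 2) (Fin 2) A))))) :
    ∃ ψ : Matrix (Fin 2) (Fin 2) A → B,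
        (∀ x y, ψ (x + y) = ψ x + ψ y) ∧ (∀ (c : ℂ) (x), ψ (c • x) = c • ψ x) ∧
        (∀ x y, ψ (x * y) = ψ x * ψ y) ∧ (∀ x, ψ (star x) = star (ψ x)) ∧
        (∀ x : Matrix (Fin 2) (Fin 2) A, IsUnit x → ψ x = φ x) := by
  obtain ⟨F, hFφ, hFc, hFm', hFs⟩ := ext_closure φ hm hs hu
  set S := closure {z : Matrix (Fin 2) (Fin 2) A | IsUnit z} with hS
  have hSm : ∀ {x y}, x ∈ S → y ∈ S → x * y ∈ S := fun hx hy => (hFm' _ hx _ hy).1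
  have hFm : ∀ {x y}, x ∈ S → y ∈ S → F (x * y) = F x * F y := fun hx hy => (hFm' _ hx _ hy).2
  have hSu : ∀ {x}, IsUnit x → x ∈ S := fun hx => subset_closure hx
  have hD : ∀ a : A, !![a, 0; 0, 0] ∈ S := diag_mem
  have hw : ∀ a : A, !![a, 1; 1, 0] ∈ S := fun a => hSu (by
    simpa using unit_swap a 0 1 one_ne_zero (Or.inr rfl))
  have hE21 : !![(0 : A), 0; 1, 0] ∈ S := by
    simpa only [Matrix.mul_fin_two, mul_zero, zero_mul, mul_one, one_mul, add_zero, zero_add] using hSm (hw 0) (hD 1)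
  have hE12 : !![(0 : A), 1; 0, 0] ∈ S := by
    simpa only [Matrix.mul_fin_two, mul_zero, zero_mul, mul_one, one_mul, add_zero, zero_add] using hSm (hD 1) (hw 0)
  have hE22 : !![(0 : A), 0; 0, 1] ∈ S := by
    simpa only [Matrix.mul_fin_two, mul_zero, zero_mul, mul_one, one_mul, add_zero, zero_add] using hSm hE21 hE12
  have h0S : (0 : Matrix (Fin 2) (Fin 2) A) ∈ S := by
    convert hD 0 using 1
    ext i j; fin_cases i <;> fin_cases j <;> rfl
  have hpath : ∀ a b : A, (a = 0 ∨ b = 0) → !![a, 0; 0, b] ∈ S →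
      Filter.Tendsto (fun lam : ℝ => φ !![a, (lam : ℂ) • 1; (lam : ℂ) • 1, b])
        (nhdsWithin 0 (Set.Ioi 0)) (nhds (F !![a, 0; 0, b])) := by
    intro a b hab hmem
    have hc : Continuous (fun l : ℝ => !![a, (l : ℂ) • 1; (l : ℂ) • 1, b]) := by
      refine continuous_matrix fun i j => ?_
      fin_cases i <;> fin_cases j <;> simp <;> fun_prop
    have h1 := hc.tendsto 0
    simp only [Complex.ofReal_zero, zero_smul] at h1
    have hunit : ∀ᶠ l : ℝ in nhdsWithin 0 (Set.Ioi 0),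
        IsUnit !![a, (l : ℂ) • 1; (l : ℂ) • 1, b] := by
      filter_upwards [self_mem_nhdsWithin] with l hl
      exact unit_swap a b l (by simpa using (ne_of_gt hl)) hab
    have h2 : Filter.Tendsto (fun l : ℝ => !![a, (l : ℂ) • 1; (l : ℂ) • 1, b])
        (nhdsWithin 0 (Set.Ioi 0)) (nhdsWithin !![a, 0; 0, b] S) :=
      tendsto_nhdsWithin_iff.2 ⟨h1.mono_left nhdsWithin_le_nhds, hunit.mono fun l h => hSu h⟩
    refine Filter.Tendsto.congr' ?_ ((hFc _ hmem).tendsto.comp h2)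
    filter_upwards [hunit] with l h
    exact hFφ _ h
  have hIu : IsUnit (Complex.I • (1 : Matrix (Fin 2) (Fin 2) A)) :=
    ⟨⟨Complex.I • 1, (-Complex.I) • 1, by simp [smul_smul], by simp [smul_smul]⟩, rfl⟩
  have hI : F (Complex.I • 1) = Complex.I • F !![1, 0; 0, 0] + Complex.I • F !![0, 0; 0, 1] := by
    rw [hFφ _ hIu]
    exact tendsto_nhds_unique hl (((hpath 1 0 (Or.inr rfl) (hD 1)).const_smul _).add
      ((hpath 0 1 (Or.inl rfl) hE22).const_smul _))
  have hF0 : F 0 = 0 := by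
    have h1 := hFm h0S (hSu hIu)
    rw [zero_mul, hI, mul_add, mul_smul_comm Complex.I (F 0), mul_smul_comm Complex.I (F 0),
      ← hFm h0S (hD 1), ← hFm h0S hE22, zero_mul, zero_mul, ← add_smul] at h1
    have h2 : (1 - (Complex.I + Complex.I)) • F 0 = 0 := by
      rw [sub_smul, one_smul, ← h1, sub_self]
    refine (smul_eq_zero.1 h2).resolve_left ?_
    intro h
    have := congrArg Complex.re h
    simp at this
  have pp : F !![1, 0; 0, 0] * F !![1, 0; 0, 0] = F !![1, 0; 0, 0] := by
    rw [← hFm (hD 1) (hD 1)]; simp only [Matrix.mul_fin_two, mul_zero, zero_mul, mul_one, one_mul, add_zero, zero_add]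
  have qq : F !![0, 0; 0, 1] * F !![0, 0; 0, 1] = F !![0, 0; 0, 1] := by
    rw [← hFm hE22 hE22]; simp only [Matrix.mul_fin_two, mul_zero, zero_mul, mul_one, one_mul, add_zero, zero_add]
  have z4 : !![(0 : A), 0; 0, 0] = 0 := by
    ext i j; fin_cases i <;> fin_cases j <;> rfl
  have pq : F !![1, 0; 0, 0] * F !![0, 0; 0, 1] = 0 := by
    rw [← hFm (hD 1) hE22]; simp only [Matrix.mul_fin_two, mul_zero, zero_mul, mul_one, one_mul, add_zero, zero_add, z4, hF0]
  have qp : F !![0, 0; 0, 1] * F !![1, 0; 0, 0] = 0 := by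
    rw [← hFm hE22 (hD 1)]; simp only [Matrix.mul_fin_two, mul_zero, zero_mul, mul_one, one_mul, add_zero, zero_add, z4, hF0]
  have hII : F (Complex.I • 1) * F (Complex.I • 1) = -(F !![1, 0; 0, 0] + F !![0, 0; 0, 1]) := by
    rw [hI]
    simp [mul_add, add_mul, pp, qq, pq, qp, smul_smul, smul_mul_assoc, mul_smul_comm]
    abel
  have hone : F 1 = F !![1, 0; 0, 0] + F !![0, 0; 0, 1] := by
    have h1 : (1 : Matrix (Fin 2) (Fin 2) A) =
        ((Complex.I • 1) * (Complex.I • 1)) * ((Complex.I • 1) * (Complex.I • 1)) := by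
      simp [smul_smul]
    rw [h1, hFm (hSm (hSu hIu) (hSu hIu)) (hSm (hSu hIu) (hSu hIu)), hFm (hSu hIu) (hSu hIu), hII]
    simp [mul_add, add_mul, pp, qq, pq, qp]
    abel
  have hFI : F (Complex.I • 1) = Complex.I • F 1 := by rw [hI, hone, smul_add]
  have h1S : (1 : Matrix (Fin 2) (Fin 2) A) ∈ S := hSu isUnit_one
  -- insertion of the resolution of the identity
  have hins : ∀ {x y}, x ∈ S → y ∈ S →
      F (x * y) = F (x * !![1, 0; 0, 0] * y) + F (x * !![0, 0; 0, 1] * y) := by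
    intro x y hx hy
    rw [hFm (hSm hx (hD 1)) hy, hFm (hSm hx hE22) hy, hFm hx (hD 1), hFm hx hE22, ← add_mul,
      ← mul_add, ← hone, ← hFm hx h1S, mul_one, hFm hx hy]
  -- the corner map
  have hadd : ∀ a b : A, F !![a + b, 0; 0, 0] = F !![a, 0; 0, 0] + F !![b, 0; 0, 0] := by
    intro a b
    have hr : !![1, b; 0, 0] ∈ S := by
      have hu' : IsUnit !![(1 : A), b; 0, 1] :=
        ⟨⟨!![1, b; 0, 1], !![1, -b; 0, 1], by simp [Matrix.mul_fin_two, Matrix.one_fin_two],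
          by simp [Matrix.mul_fin_two, Matrix.one_fin_two]⟩, rfl⟩
      simpa only [Matrix.mul_fin_two, mul_zero, zero_mul, mul_one, one_mul, add_zero, zero_add] using hSm (hD 1) (hSu hu')
    have hc : !![a, 0; 1, 0] ∈ S := by
      simpa only [Matrix.mul_fin_two, mul_zero, zero_mul, mul_one, one_mul, add_zero, zero_add] using hSm (hw a) (hD 1)
    simpa only [Matrix.mul_fin_two, mul_zero, zero_mul, mul_one, one_mul, add_zero, zero_add] using hins hr hc
  have hmul : ∀ a b : A, F !![a * b, 0; 0, 0] = F !![a, 0; 0, 0] * F !![b, 0; 0, 0] := by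
    intro a b
    rw [← hFm (hD a) (hD b)]; simp only [Matrix.mul_fin_two, mul_zero, zero_mul, mul_one, one_mul, add_zero, zero_add]
  have hst : ∀ a : A, F !![star a, 0; 0, 0] = star (F !![a, 0; 0, 0]) := by
    intro a
    rw [← hFs _ (hD a)]
    congr 1
    ext i j; fin_cases i <;> fin_cases j <;> simp [Matrix.star_apply]
  have hcont : Continuous fun a : A => F !![a, 0; 0, 0] := by
    refine hFc.comp_continuous ?_ hD
    refine continuous_matrix fun i j => ?_
    fin_cases i <;> fin_cases j <;> simp <;> fun_prop
  let α₀ : A →+ B := AddMonoidHom.mk' (fun a => F !![a, 0; 0, 0]) hadd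
  have hreal : ∀ (r : ℝ) (a : A), F !![(r : ℂ) • a, 0; 0, 0] = (r : ℂ) • F !![a, 0; 0, 0] := by
    intro r a
    exact map_real_smul α₀ hcont r a
  have hIa : ∀ a : A, F !![Complex.I • a, 0; 0, 0] = Complex.I • F !![a, 0; 0, 0] := by
    intro a
    have : !![Complex.I • a, 0; 0, 0] = (Complex.I • 1) * !![a, 0; 0, 0] := by
      rw [smul_mul_assoc, one_mul]
      ext i j; fin_cases i <;> fin_cases j <;> simp
    rw [this, hFm (hSu hIu) (hD a), hFI, smul_mul_assoc, ← hFm h1S (hD a), one_mul]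
  have hsmul : ∀ (c : ℂ) (a : A), F !![c • a, 0; 0, 0] = c • F !![a, 0; 0, 0] := by
    intro c a
    have h1 : c • a = (c.re : ℂ) • a + Complex.I • ((c.im : ℂ) • a) := by
      rw [smul_smul, ← add_smul, mul_comm Complex.I, Complex.re_add_im]
    rw [h1, hadd, hIa, hreal, hreal, smul_smul, ← add_smul, mul_comm Complex.I,
      Complex.re_add_im]
  let u : Fin 2 → Matrix (Fin 2) (Fin 2) A := ![!![1, 0; 0, 0], !![0, 0; 1, 0]]
  let v : Fin 2 → Matrix (Fin 2) (Fin 2) A := ![!![1, 0; 0, 0], !![0, 1; 0, 0]]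
  have huS : ∀ i, u i ∈ S := by intro i; fin_cases i; exacts [hD 1, hE21]
  have hvS : ∀ i, v i ∈ S := by intro i; fin_cases i; exacts [hD 1, hE12]
  have hvu : ∀ j k, v j * u k = if j = k then !![1, 0; 0, 0] else 0 := by
    intro j k
    fin_cases j <;> fin_cases k <;>
      ext a b <;> fin_cases a <;> fin_cases b <;> simp [u, v]
  have hsu : ∀ i, star (F (u i)) = F (v i) := by
    intro i
    rw [← hFs _ (huS i)]
    congr 1
    ext k j; fin_cases i <;> fin_cases k <;> fin_cases j <;> simp [u, v, Matrix.star_apply]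
  have hsv : ∀ i, star (F (v i)) = F (u i) := by
    intro i
    rw [← hsu, star_star]
  have hprod : ∀ i j k l (a b : A), (F (u i) * F !![a, 0; 0, 0] * F (v j)) *
      (F (u k) * F !![b, 0; 0, 0] * F (v l)) =
      if j = k then F (u i) * F !![a * b, 0; 0, 0] * F (v l) else 0 := by
    intro i j k l a b
    have : (F (u i) * F !![a, 0; 0, 0] * F (v j)) * (F (u k) * F !![b, 0; 0, 0] * F (v l))
        = F (u i) * F !![a, 0; 0, 0] * F (v j * u k) * F !![b, 0; 0, 0] * F (v l) := by
      rw [hFm (hvS j) (huS k)]; simp only [mul_assoc]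
    rw [this, hvu]
    split_ifs with h
    · rw [mul_assoc (F (u i)), ← hmul, mul_one, mul_assoc (F (u i)), ← hmul]
    · simp [hF0]
  refine ⟨fun x => ∑ i, ∑ j, F (u i) * F !![x i j, 0; 0, 0] * F (v j), ?_, ?_, ?_, ?_, ?_⟩
  · intro x y
    simp only [Matrix.add_apply, hadd, mul_add, add_mul, Finset.sum_add_distrib]
  · intro c x
    simp only [Matrix.smul_apply, hsmul, mul_smul_comm, smul_mul_assoc, Finset.smul_sum]
  · intro x y
    simp only [Matrix.mul_apply, Fin.sum_univ_two, mul_add, add_mul, hprod, hadd]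
    simp
    abel
  · intro x
    simp only [Matrix.star_apply, hst, star_sum, star_mul, hsu, hsv, ← mul_assoc]
    exact Finset.sum_comm
  · intro x hx
    rw [← hFφ x hx]
    have hxS := hSu hx
    have hterm : ∀ i j a, F (u i) * F !![a, 0; 0, 0] * F (v j) =
        F (u i * !![a, 0; 0, 0] * v j) := by
      intro i j a
      rw [hFm (hSm (huS i) (hD a)) (hvS j), hFm (huS i) (hD a)]
    have h1 := hins (x := 1) (y := x) h1S hxS
    have h2 := hins (x := !![1, 0; 0, 0] * x) (y := 1) (hSm (hD 1) hxS) h1S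
    have h3 := hins (x := !![0, 0; 0, 1] * x) (y := 1) (hSm hE22 hxS) h1S
    simp only [one_mul, mul_one] at h1 h2 h3
    rw [h1, h2, h3]
    simp only [Fin.sum_univ_two, hterm]
    rw [Matrix.eta_fin_two x]
    simp [u, v, Matrix.mul_fin_two]

theorem forward (φ ψ : Matrix (Fin 2) (Fin 2) A → B)
    (ha : ∀ x y, ψ (x + y) = ψ x + ψ y) (hc : ∀ (c : ℂ) (x), ψ (c • x) = c • ψ x)
    (hm : ∀ x y, ψ (x * y) = ψ x * ψ y) (hs : ∀ x, ψ (star x) = star (ψ x))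
    (he : ∀ x : Matrix (Fin 2) (Fin 2) A, IsUnit x → ψ x = φ x) :
    (∀ x y : Matrix (Fin 2) (Fin 2) A, IsUnit x → IsUnit y →
          φ (x * y) = φ x * φ y) ∧
        (∀ x : Matrix (Fin 2) (Fin 2) A, IsUnit x →
          φ (star x) = star (φ x)) ∧
        UniformContinuousOn φ {z : Matrix (Fin 2) (Fin 2) A | IsUnit z} ∧
        Filter.Tendsto
          (fun lam : ℝ =>
            Complex.I • φ !![(1 : A), (lam : ℂ) • 1; (lam : ℂ) • 1, 0] +
            Complex.I • φ !![(0 : A), (lam : ℂ) • 1; (lam : ℂ) • 1, 1])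
          (nhdsWithin 0 (Set.Ioi 0))
          (nhds (φ (Complex.I • (1 : Matrix (Fin 2) (Fin 2) A)))) := by
  have h0 : ψ 0 = 0 := by simpa using hc 0 0
  have z4 : !![(0 : A), 0; 0, 0] = 0 := by
    ext i j; fin_cases i <;> fin_cases j <;> rfl
  let α : A →⋆ₙₐ[ℂ] B :=
    { toFun := fun a => ψ !![a, 0; 0, 0]
      map_smul' := by
        intro c a
        rw [MonoidHom.id_apply, ← hc]; congr 1
        ext i j; fin_cases i <;> fin_cases j <;> simp
      map_zero' := by rw [z4, h0]
      map_add' := by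
        intro a b
        rw [← ha]; simp
      map_mul' := by
        intro a b
        rw [← hm]; simp only [Matrix.mul_fin_two, mul_zero, zero_mul, mul_one, one_mul, add_zero, zero_add]
      map_star' := by
        intro a
        rw [← hs]; congr 1
        ext i j; fin_cases i <;> fin_cases j <;> simp [Matrix.star_apply] }
  have hα : Continuous α :=
    AddMonoidHomClass.continuous_of_bound α 1 fun a => by
      simpa using NonUnitalStarAlgHom.norm_apply_le α a
  let u : Fin 2 → Matrix (Fin 2) (Fin 2) A := ![!![1, 0; 0, 0], !![0, 0; 1, 0]]
  let v : Fin 2 → Matrix (Fin 2) (Fin 2) A := ![!![1, 0; 0, 0], !![0, 1; 0, 0]]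
  have hψ : ψ = fun x => ∑ i, ∑ j, ψ (u i) * α (x i j) * ψ (v j) := by
    funext x
    change ψ x = ∑ i, ∑ j, ψ (u i) * ψ !![x i j, 0; 0, 0] * ψ (v j)
    simp only [← hm, Fin.sum_univ_two, ← ha]
    congr 1
    ext i j; fin_cases i <;> fin_cases j <;> simp [u, v, Matrix.mul_fin_two]
  have hψc : Continuous ψ := by
    rw [hψ]
    refine continuous_finsetSum _ fun i _ => continuous_finsetSum _ fun j _ => ?_
    have : Continuous fun x : Matrix (Fin 2) (Fin 2) A => x i j := continuous_id.matrix_elem i j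
    exact (continuous_const.mul (hα.comp this)).mul continuous_const
  have hψu : UniformContinuous ψ :=
    uniformContinuous_addMonoidHom_of_continuous (f := AddMonoidHom.mk' ψ ha) hψc
  have hIu : IsUnit (Complex.I • (1 : Matrix (Fin 2) (Fin 2) A)) :=
    ⟨⟨Complex.I • 1, (-Complex.I) • 1, by simp [smul_smul], by simp [smul_smul]⟩, rfl⟩
  refine ⟨?_, ?_, ?_, ?_⟩
  · intro x y hx hy
    rw [← he _ hx, ← he _ hy, ← he _ (hx.mul hy), hm]
  · intro x hx
    rw [← he _ hx, ← he _ hx.star, hs]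
  · exact hψu.uniformContinuousOn.congr fun x hx => he x hx
  · rw [← he _ hIu]
    have hcc : Continuous fun l : ℝ => ψ (Complex.I • (!![(1 : A), (l : ℂ) • 1; (l : ℂ) • 1, 0] +
        !![(0 : A), (l : ℂ) • 1; (l : ℂ) • 1, 1])) := by
      refine hψc.comp ?_
      refine continuous_matrix fun i j => ?_
      fin_cases i <;> fin_cases j <;> simp <;> fun_prop
    have h1 := (hcc.tendsto 0).mono_left (nhdsWithin_le_nhds (s := Set.Ioi 0))
    have h2 : (!![(1 : A), ((0 : ℝ) : ℂ) • 1; ((0 : ℝ) : ℂ) • 1, 0] +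
        !![(0 : A), ((0 : ℝ) : ℂ) • 1; ((0 : ℝ) : ℂ) • 1, 1]) = 1 := by
      ext i j; fin_cases i <;> fin_cases j <;> simp
    rw [h2] at h1
    refine h1.congr' ?_
    filter_upwards [self_mem_nhdsWithin] with l hl
    have hl' : (l : ℂ) ≠ 0 := by simpa using (ne_of_gt hl)
    rw [smul_add, ha, hc, hc, he _ (unit_swap 1 0 _ hl' (Or.inr rfl)),
      he _ (unit_swap 0 1 _ hl' (Or.inl rfl))]

end

/-- Let `A` and `B` be C*-algebras with `A` unital, and let
`φ` be an arbitrary function on `GL(M₂(A))` (modelled as a total function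
whose relevant values are those on the invertible matrices).  Then `φ`
extends to a `*`-homomorphism `M₂(A) → B` if and only if `φ` is a
`*`-semigroup homomorphism on the invertibles, is uniformly continuous, and
`φ([[i,0],[0,i]])` equals the limit, as `λ → 0⁺`, of
`i·φ([[1,λ],[λ,0]]) + i·φ([[0,λ],[λ,1]])`. -/
theorem stmt_10 {A B : Type*} [CStarAlgebra A] [NonUnitalCStarAlgebra B]
    (φ : Matrix (Fin 2) (Fin 2) A → B) :
    (∃ ψ : Matrix (Fin 2) (Fin 2) A → B,
        (∀ x y, ψ (x + y) = ψ x + ψ y) ∧ (∀ (c : ℂ) (x), ψ (c • x) = c • ψ x) ∧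
        (∀ x y, ψ (x * y) = ψ x * ψ y) ∧ (∀ x, ψ (star x) = star (ψ x)) ∧
        (∀ x : Matrix (Fin 2) (Fin 2) A, IsUnit x → ψ x = φ x)) ↔
      ((∀ x y : Matrix (Fin 2) (Fin 2) A, IsUnit x → IsUnit y →
          φ (x * y) = φ x * φ y) ∧
        (∀ x : Matrix (Fin 2) (Fin 2) A, IsUnit x →
          φ (star x) = star (φ x)) ∧
        UniformContinuousOn φ {z : Matrix (Fin 2) (Fin 2) A | IsUnit z} ∧
        Filter.Tendsto
          (fun lam : ℝ =>
            Complex.I • φ !![(1 : A), (lam : ℂ) • 1; (lam : ℂ) • 1, 0] +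
            Complex.I • φ !![(0 : A), (lam : ℂ) • 1; (lam : ℂ) • 1, 1])
          (nhdsWithin 0 (Set.Ioi 0))
          (nhds (φ (Complex.I • (1 : Matrix (Fin 2) (Fin 2) A))))) := by
  constructor
  · rintro ⟨ψ, ha, hc, hm, hs, he⟩
    exact forward φ ψ ha hc hm hs he
  · rintro ⟨hm, hs, hu, hl⟩
    exact backward φ hm hs hu hl
end
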